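/- Let n be a positive odd integer with n ≥ 114, n ≡ 2 (mod 5) and n ≡ 2 (mod 3). Then for every finite abelian group H of order n²+n+1 there exist no inverse-closed subsets T₀, T₁ of H with e ∈ T₀ satisfying the APLL group-ring equations. -/

import Mathlib

open scoped Classical Pointwise

/-- The APLL group-ring equations, stated via coefficient counts: for every `h ∈ H`,
`#{(a,b) ∈ T₀×T₁ : ab = h} = 1 − [h = e]`, and
`#{(a,b) ∈ T₀×T₀ : ab = h} + #{(a,b) ∈ T₁×T₁ : ab = h} + #{t ∈ T₀ : t² = h}
  + #{t ∈ T₁ : t² = h} = 2 + 2n·[h = e]`. -/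
def APLLEqs {H : Type*} [CommGroup H] (n : ℕ) (T₀ T₁ : Set H) : Prop :=
  (∀ h : H,
      {p : H × H | p.1 ∈ T₀ ∧ p.2 ∈ T₁ ∧ p.1 * p.2 = h}.ncard
        = if h = 1 then 0 else 1) ∧
  (∀ h : H,
      {p : H × H | p.1 ∈ T₀ ∧ p.2 ∈ T₀ ∧ p.1 * p.2 = h}.ncard
        + {p : H × H | p.1 ∈ T₁ ∧ p.2 ∈ T₁ ∧ p.1 * p.2 = h}.ncard
        + {t : H | t ∈ T₀ ∧ t ^ 2 = h}.ncard
        + {t : H | t ∈ T₁ ∧ t ^ 2 = h}.ncard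
        = 2 + if h = 1 then 2 * n else 0)

/-- `Xset T₀ T₁ i` is the set of `h ∈ H` appearing with coefficient `i` in `T̂⁽²⁾T₀`. -/
def Xset {H : Type*} [CommGroup H] (T₀ T₁ : Set H) (i : ℕ) : Set H :=
  {h : H | {p : H × H | p.1 ∈ T₀ ∪ T₁ ∧ p.2 ∈ T₀ ∧ p.1 ^ 2 * p.2 = h}.ncard = i}

/-- `Yset T₀ T₁ i` is the set of `h ∈ H` appearing with coefficient `i` in `T̂⁽²⁾T₁`. -/
def Yset {H : Type*} [CommGroup H] (T₀ T₁ : Set H) (i : ℕ) : Set H :=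
  {h : H | {p : H × H | p.1 ∈ T₀ ∪ T₁ ∧ p.2 ∈ T₁ ∧ p.1 ^ 2 * p.2 = h}.ncard = i}

/-- `Vset T₀ T₁ i` is the set of `h ∈ H` appearing with coefficient `i` in `T̂⁽⁴⁾T₁`. -/
def Vset {H : Type*} [CommGroup H] (T₀ T₁ : Set H) (i : ℕ) : Set H :=
  {h : H | {p : H × H | p.1 ∈ T₀ ∪ T₁ ∧ p.2 ∈ T₁ ∧ p.1 ^ 4 * p.2 = h}.ncard = i}

/-- `θ₀ = |(T₀T₀ ∖ T₀⁽²⁾) ∩ T̂⁽⁴⁾|`. -/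
noncomputable def theta0 {H : Type*} [CommGroup H] (T₀ T₁ : Set H) : ℕ :=
  (((T₀ * T₀) \ ((fun t => t ^ 2) '' T₀)) ∩ ((fun g => g ^ 4) '' (T₀ ∪ T₁))).ncard

/-- `θ₁ = |T₁ ∩ T̂⁽²⁾|/2 + |(T₁T₁ ∖ (T₁⁽²⁾ ∪ {e})) ∩ T̂⁽⁴⁾|`, as a rational number. -/
noncomputable def theta1 {H : Type*} [CommGroup H] (T₀ T₁ : Set H) : ℚ :=
  ((T₁ ∩ ((fun g => g ^ 2) '' (T₀ ∪ T₁))).ncard : ℚ) / 2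
    + ((((T₁ * T₁) \ (((fun t => t ^ 2) '' T₁) ∪ {1}))
        ∩ ((fun g => g ^ 4) '' (T₀ ∪ T₁))).ncard : ℚ)

/-- `s_i = (i−1)(i−4)/2` if `i ≡ 1 (mod 3)`, and `(i−2)(i−3)/2` otherwise. -/
def sCoef (i : ℕ) : ℚ :=
  if i % 3 = 1 then ((i : ℚ) - 1) * ((i : ℚ) - 4) / 2
  else ((i : ℚ) - 2) * ((i : ℚ) - 3) / 2

namespace APLL

open MonoidAlgebra

/-- If `p` is prime, then raising to the `p`-th power is additive modulo `p`. -/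
lemma prime_dvd_sum_pow_sub {R ι : Type*} [CommRing R] {p : ℕ} (hp : p.Prime)
    (s : Finset ι) (f : ι → R) : (p : R) ∣ (∑ i ∈ s, f i) ^ p - ∑ i ∈ s, f i ^ p := by
  induction s using Finset.induction_on with
  | empty => simp [hp.ne_zero]
  | insert i s hi ih =>
    obtain ⟨c, hc⟩ := ih
    obtain ⟨r, hr⟩ := exists_add_pow_prime_eq hp (f i) (∑ j ∈ s, f j)
    rw [Finset.sum_insert hi, Finset.sum_insert hi, hr]
    exact ⟨c + f i * (∑ j ∈ s, f j) * r, by linear_combination hc⟩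

variable {H : Type*} [CommGroup H]

/-- The element of the integral group ring attached to a finite set. -/
noncomputable def setSum (s : Finset H) : MonoidAlgebra ℤ H := ∑ t ∈ s, single t 1

/-- The ring endomorphism of the group ring induced by `g ↦ g ^ k`. -/
noncomputable def powHom (k : ℕ) : MonoidAlgebra ℤ H →+* MonoidAlgebra ℤ H :=
  mapDomainRingHom ℤ (powMonoidHom k)

/-- The ring endomorphism of the group ring induced by inversion. -/
noncomputable def invHom : MonoidAlgebra ℤ H →+* MonoidAlgebra ℤ H :=
  mapDomainRingHom ℤ invMonoidHom

lemma powHom_single (k : ℕ) (t : H) (z : ℤ) : powHom k (single t z) = single (t ^ k) z := by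
  simp [powHom]

lemma invHom_single (t : H) (z : ℤ) : invHom (single t z) = single t⁻¹ z := by
  simp [invHom]

lemma powHom_setSum (k : ℕ) (s : Finset H) :
    powHom k (setSum s) = ∑ t ∈ s, single (t ^ k) 1 := by
  simp [setSum, powHom_single]

lemma prime_dvd_setSum_pow_sub {p : ℕ} (hp : p.Prime) (s : Finset H) :
    (p : MonoidAlgebra ℤ H) ∣ setSum s ^ p - powHom p (setSum s) := by
  have := prime_dvd_sum_pow_sub hp s (fun t : H => (single t 1 : MonoidAlgebra ℤ H))
  rw [powHom_setSum, setSum]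
  simpa [single_pow] using this

lemma coeff_intCast_mul (m : ℤ) (x : MonoidAlgebra ℤ H) (g : H) :
    ((m : MonoidAlgebra ℤ H) * x).coeff g = m * x.coeff g := by
  rw [← zsmul_eq_mul, coeff_smul_apply, zsmul_eq_mul, Int.cast_id]

lemma powHom_coeff_nonneg (k : ℕ) {x : MonoidAlgebra ℤ H} (hx : ∀ g, 0 ≤ x.coeff g) (g : H) :
    0 ≤ (powHom k x).coeff g := by
  rw [← sum_coeff_single x, Finsupp.sum, map_sum, coeff_sum, Finsupp.finsetSum_apply]
  refine Finset.sum_nonneg fun t _ => ?_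
  rw [powHom_single, coeff_single, Finsupp.single_apply]
  split_ifs
  exacts [hx t, le_rfl]

lemma coeff_setSum {H : Type*} (s : Finset H) (g : H) :
    (setSum s).coeff g = if g ∈ s then 1 else 0 := by
  rw [setSum, coeff_sum, Finsupp.finsetSum_apply]
  simp [Finsupp.single_apply]

lemma coeff_setSum_mul (s t : Finset H) (h : H) :
    (setSum s * setSum t).coeff h
      = {p : H × H | p.1 ∈ s ∧ p.2 ∈ t ∧ p.1 * p.2 = h}.ncard := by
  have : {p : H × H | p.1 ∈ s ∧ p.2 ∈ t ∧ p.1 * p.2 = h}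
      = ((s ×ˢ t).filter fun p => p.1 * p.2 = h : Finset (H × H)) := by
    ext p; simp [and_assoc]
  rw [this, Set.ncard_coe_finset, setSum, setSum, Finset.sum_mul_sum, ← Finset.sum_product',
    coeff_sum, Finsupp.finsetSum_apply]
  simp [Finsupp.single_apply]

lemma coeff_powHom_setSum (k : ℕ) (s : Finset H) (h : H) :
    (powHom k (setSum s)).coeff h = {t : H | t ∈ s ∧ t ^ k = h}.ncard := by
  have : {t : H | t ∈ s ∧ t ^ k = h} = (s.filter fun t => t ^ k = h : Finset H) := by
    ext p; simp
  rw [this, Set.ncard_coe_finset, powHom_setSum, coeff_sum, Finsupp.finsetSum_apply]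
  simp [Finsupp.single_apply]

lemma coeff_invHom (x : MonoidAlgebra ℤ H) (g : H) : (invHom x).coeff g = x.coeff g⁻¹ := by
  have := Finsupp.mapDomain_apply (inv_injective (G := H)) x.coeff g⁻¹
  rw [inv_inv] at this
  exact this

lemma invHom_setSum {s : Finset H} (hs : ∀ t, t⁻¹ ∈ s ↔ t ∈ s) :
    invHom (setSum s) = setSum s := by
  ext g
  rw [coeff_invHom, coeff_setSum, coeff_setSum]
  simp [hs]

lemma invHom_powHom (k : ℕ) (x : MonoidAlgebra ℤ H) :
    invHom (powHom k x) = powHom k (invHom x) := by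
  have : (invHom (H := H)).comp (powHom k) = (powHom k).comp invHom := by
    refine MonoidAlgebra.ringHom_ext (fun r => ?_) fun g => ?_ <;>
      simp [powHom_single, invHom_single]
  exact RingHom.congr_fun this x

lemma coeff_powHom_one_of_injective {k : ℕ} (hk : Function.Injective fun g : H => g ^ k)
    (x : MonoidAlgebra ℤ H) : (powHom k x).coeff 1 = x.coeff 1 := by
  have := Finsupp.mapDomain_apply hk x.coeff 1
  simp only [one_pow] at this
  exact this

variable [Fintype H]

lemma coeff_mul_eq_sum (x y : MonoidAlgebra ℤ H) (g : H) :
    (x * y).coeff g = ∑ u, x.coeff u * y.coeff (u⁻¹ * g) := by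
  rw [coeff_mul_apply_left, Finsupp.sum_fintype _ _ (by simp)]

/-- The augmentation map of the integral group ring. -/
noncomputable def aug : MonoidAlgebra ℤ H →+* ℤ where
  toFun x := ∑ g, x.coeff g
  map_zero' := by simp
  map_one' := by simp [one_def, Finsupp.single_apply]
  map_add' x y := by simp [Finset.sum_add_distrib]
  map_mul' x y := by
    simp_rw [coeff_mul_eq_sum]
    rw [Finset.sum_comm, Finset.sum_mul]
    refine Finset.sum_congr rfl fun u _ => ?_
    rw [← Finset.mul_sum]
    congr 1
    exact Equiv.sum_comp (Equiv.mulLeft u⁻¹) fun g => y.coeff g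

lemma aug_apply (x : MonoidAlgebra ℤ H) : aug x = ∑ g, x.coeff g := rfl

lemma aug_single (t : H) (z : ℤ) : aug (single t z) = z := by
  simp [aug_apply, Finsupp.single_apply]

lemma aug_setSum (s : Finset H) : aug (setSum s) = s.card := by
  simp [setSum, aug_single]

lemma aug_powHom (k : ℕ) (x : MonoidAlgebra ℤ H) : aug (powHom k x) = aug x := by
  have : (aug (H := H)).comp (powHom k) = aug := by
    refine MonoidAlgebra.ringHom_ext (fun r => ?_) fun g => ?_ <;>
      simp [powHom_single, aug_single]
  exact RingHom.congr_fun this x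

lemma setSum_univ_mul (x : MonoidAlgebra ℤ H) :
    setSum Finset.univ * x = (aug x : MonoidAlgebra ℤ H) * setSum Finset.univ := by
  ext g
  rw [← zsmul_eq_mul, coeff_smul_apply, mul_comm, coeff_mul_eq_sum]
  simp [coeff_setSum, aug_apply]

lemma powHom_setSum_univ {k : ℕ} (hk : Function.Injective fun g : H => g ^ k) :
    powHom k (setSum (Finset.univ : Finset H)) = setSum Finset.univ := by
  rw [powHom_setSum, setSum]
  exact (Finite.injective_iff_bijective.mp hk).sum_comp fun g => (single g 1 : MonoidAlgebra ℤ H)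

lemma sum_sq_coeff {x : MonoidAlgebra ℤ H} (hx : invHom x = x) :
    ∑ g, x.coeff g ^ 2 = (x * x).coeff 1 := by
  rw [coeff_mul_eq_sum]
  refine Finset.sum_congr rfl fun g _ => ?_
  rw [mul_one, ← coeff_invHom, hx, sq]

lemma coeff_mul_nonneg {x y : MonoidAlgebra ℤ H} (hx : ∀ g, 0 ≤ x.coeff g)
    (hy : ∀ g, 0 ≤ y.coeff g) (g : H) : 0 ≤ (x * y).coeff g := by
  rw [coeff_mul_eq_sum]
  exact Finset.sum_nonneg fun u _ => mul_nonneg (hx _) (hy _)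

lemma coeff_mul_le {x y : MonoidAlgebra ℤ H} {c : ℤ} (hx : ∀ g, 0 ≤ x.coeff g)
    (hy : ∀ g, y.coeff g ≤ c) (g : H) : (x * y).coeff g ≤ aug x * c := by
  rw [coeff_mul_eq_sum, aug_apply, Finset.sum_mul]
  exact Finset.sum_le_sum fun u _ => mul_le_mul_of_nonneg_left (hy _) (hx _)

lemma pow_two_injective_of_odd_card (hH : Odd (Fintype.card H)) :
    Function.Injective fun g : H => g ^ 2 :=
  (powCoprime (G := H) (n := 2) (by
    rw [Nat.card_eq_fintype_card]; exact hH.coprime_two_right)).injective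

/-- An inverse-closed subset of a group of odd order has odd size if it contains the identity. -/
lemma odd_card_of_inv_mem {s : Finset H} (hH : Odd (Fintype.card H))
    (hs : ∀ t, t⁻¹ ∈ s ↔ t ∈ s) (h1 : 1 ∈ s) : Odd s.card := by
  have hsq : ∀ t : H, t⁻¹ = t → t = 1 := fun t ht => by
    have h2 : orderOf t ∣ 2 := orderOf_dvd_of_pow_eq_one (by
      rw [sq]; nth_rewrite 1 [← ht]; simp)
    have h3 := Nat.eq_one_of_dvd_coprimes hH.coprime_two_left h2 orderOf_dvd_card
    exact orderOf_eq_one_iff.mp h3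
  have h0 : ∑ _t ∈ s.erase 1, (1 : ZMod 2) = 0 :=
    Finset.sum_involution (fun t _ => t⁻¹) (fun _ _ => by decide)
      (fun t ht _ h => (Finset.mem_erase.mp ht).1 (hsq t h))
      (fun t ht => by simpa [hs] using ht) (fun t _ => inv_inv t)
  rw [Finset.sum_const, nsmul_one, ZMod.natCast_eq_zero_iff_even] at h0
  rw [← Finset.card_erase_add_one h1]
  exact h0.add_one

lemma coeff_powHom_one_le {k : ℕ} (hk : Function.Injective fun g : H => g ^ k)
    {x : MonoidAlgebra ℤ H} {c : ℤ} (hx : ∀ g, 0 ≤ (powHom k x).coeff g)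
    (hc : ∀ g, x.coeff g ≤ c) :
    (powHom k (powHom k x) * powHom k x).coeff 1 ≤ aug x * c := by
  rw [← map_mul, coeff_powHom_one_of_injective hk, ← aug_powHom k]
  exact coeff_mul_le hx hc 1

/-- Of two nonnegative integers with product `n(n+1)` and sum of squares as below, one is `n`. -/
lemma eq_or_eq_of_mul_of_sq {n s t : ℤ} (hn : 0 ≤ n) (hs : 0 ≤ s) (ht : 0 ≤ t)
    (hmul : s * t = n ^ 2 + n)
    (hsq : s ^ 2 + t ^ 2 + (s + t) = 2 * (n ^ 2 + n + 1) + 2 * n) :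
    s = n ∧ t = n + 1 ∨ s = n + 1 ∧ t = n := by
  have h : (s + t - (2 * n + 1)) * (s + t + (2 * n + 2)) = 0 := by
    linear_combination hsq + 2 * hmul
  have hsum : s + t = 2 * n + 1 := by
    rcases mul_eq_zero.mp h with h | h <;> linarith
  have h' : (s - n) * (s - (n + 1)) = 0 := by
    linear_combination s * hsum - hmul
  rcases mul_eq_zero.mp h' with h | h
  · left; constructor <;> linarith
  · right; constructor <;> linarith

/-- The pointwise inequality behind the counting argument. -/
lemma thirteen_le {x₀ x₁ y : ℤ} (h₀ : x₀ % 3 = 1) (h₁ : x₁ % 3 = 1)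
    (hx₀ : 0 ≤ x₀) (hx₁ : 0 ≤ x₁) (hy : 0 ≤ y) (hmod : y % 5 = (2 + 2 * x₁ - x₀) % 5) :
    13 ≤ 3 * y + (x₀ - 1) ^ 2 + (x₁ - 3) ^ 2 := by
  rcases le_or_gt 7 x₀ with h | h
  · nlinarith [sq_nonneg (x₁ - 3)]
  rcases le_or_gt 7 x₁ with h' | h'
  · nlinarith [sq_nonneg (x₀ - 1)]
  have e₀ : x₀ = 1 ∨ x₀ = 4 := by omega
  have e₁ : x₁ = 1 ∨ x₁ = 4 := by omega
  rcases e₀ with rfl | rfl <;> rcases e₁ with rfl | rfl <;> norm_num <;> omega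

section Identities

variable {R : Type*} [CommRing R] {a b u p q m : R}

lemma mul_left_eq (hmul : a * b = u - 1) (hsq : a ^ 2 + b ^ 2 = 2 * u - p + 2 * m)
    (hua : u * a = m * u) (hub : u * b = (m + 1) * u) :
    p * a = (m - 1) * u + 2 * m * a + b - a ^ 3 := by
  linear_combination a * hsq - b * hmul + 2 * hua - hub

lemma mul_right_eq (hmul : a * b = u - 1) (hsq : a ^ 2 + b ^ 2 = 2 * u - p + 2 * m)
    (hua : u * a = m * u) (hub : u * b = (m + 1) * u) :
    p * b = (m + 2) * u + 2 * m * b + a - b ^ 3 := by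
  linear_combination b * hsq - a * hmul + 2 * hub - hua

lemma mul_right_eq_of_sq (hmul : a * b = u - 1) (hsq : a ^ 2 + b ^ 2 = 2 * u - p + 2 * m)
    (hua : u * a = m * u) (hub : u * b = (m + 1) * u) (hup : u * p = (2 * m + 1) * u)
    (hp : p ^ 2 = 4 * u - q + (2 * m - 2)) :
    q * b = (m ^ 3 + 4 * m ^ 2 + 9 * m + 5) * u + (4 * m ^ 2 + 2 * m - 3) * b + 2 * m * a
      - 4 * m * (p * b) - p * a - b ^ 5 := by
  linear_combination b * hp + 4 * hub
    + (b ^ 2 - p + 2 * m) * mul_right_eq hmul hsq hua hub - (m + 2) * hup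
    + (m + 2) * (b + (m + 1)) * hub + b * hmul + hub

lemma sq_mul_eq (hsq : a ^ 2 + b ^ 2 = 2 * u - p + 2 * m)
    (huu : u * u = (m ^ 2 + m + 1) * u) (hup : u * p = (2 * m + 1) * u)
    (huq : u * q = (2 * m + 1) * u) (hp : p ^ 2 = 4 * u - q + (2 * m - 2)) :
    p ^ 2 * (a ^ 2 + b ^ 2) = (8 * m ^ 2 + 8 * m - 2) * u + q * p - 2 * m * q
      - (2 * m - 2) * p + 2 * m * (2 * m - 2) := by
  rw [hsq, hp]
  linear_combination 8 * huu - 4 * hup - 2 * huq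

end Identities

lemma odd_sq_add_add_one (n : ℕ) : Odd (n ^ 2 + n + 1) := by
  have := (Nat.even_mul_succ_self n).add_one
  rwa [Nat.mul_succ, ← sq] at this

/-- There is no pair of sets satisfying the equations in the integral group ring. -/
lemma false_of_groupRing_eqs {n : ℕ} {s t : Finset H} (hge : 114 ≤ n) (hn5 : n % 5 = 2)
    (hn3 : n % 3 = 2) (hcard : Fintype.card H = n ^ 2 + n + 1)
    (hs : ∀ g, g⁻¹ ∈ s ↔ g ∈ s) (ht : ∀ g, g⁻¹ ∈ t ↔ g ∈ t)
    (hsc : s.card = n) (htc : t.card = n + 1)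
    (hmul : setSum s * setSum t = setSum Finset.univ - 1)
    (hsq : setSum s ^ 2 + setSum t ^ 2 = 2 * setSum Finset.univ
      - powHom 2 (setSum s + setSum t) + 2 * (n : MonoidAlgebra ℤ H)) : False := by
  have h2 : Function.Injective fun g : H => g ^ 2 :=
    pow_two_injective_of_odd_card (hcard ▸ odd_sq_add_add_one n)
  set a := setSum s with ha
  set b := setSum t with hb
  set u : MonoidAlgebra ℤ H := setSum Finset.univ with hu
  set p := powHom 2 (a + b) with hp
  set q := powHom 2 p with hq
  set m : MonoidAlgebra ℤ H := (n : MonoidAlgebra ℤ H) with hm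
  have augA : aug a = n := by rw [ha, aug_setSum, hsc]
  have augB : aug b = n + 1 := by rw [hb, aug_setSum, htc]; push_cast; rfl
  have augP : aug p = 2 * n + 1 := by rw [hp, aug_powHom, map_add, augA, augB]; ring
  have augQ : aug q = 2 * n + 1 := by rw [hq, aug_powHom, augP]
  have hua : u * a = m * u := by rw [hu, setSum_univ_mul, augA]; simp [hm]
  have hub : u * b = (m + 1) * u := by rw [hu, setSum_univ_mul, augB]; simp [hm]
  have hup : u * p = (2 * m + 1) * u := by rw [hu, setSum_univ_mul, augP]; simp [hm]
  have huq : u * q = (2 * m + 1) * u := by rw [hu, setSum_univ_mul, augQ]; simp [hm]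
  have huu : u * u = (m ^ 2 + m + 1) * u := by
    rw [hu, setSum_univ_mul, aug_setSum, Finset.card_univ, hcard]; simp [hm]
  have hpp : p ^ 2 = 4 * u - q + (2 * m - 2) := by
    have : (a + b) ^ 2 = 4 * u - p + (2 * m - 2) := by linear_combination hsq + 2 * hmul
    have h := congrArg (powHom 2) this
    rw [map_pow, ← hp, map_add, map_sub, map_mul, hu, powHom_setSum_univ h2, ← hu, ← hq] at h
    rw [h]
    simp only [map_sub, map_mul, map_ofNat, map_natCast, hm]
  have hx₀ := mul_left_eq hmul hsq hua hub
  have hx₁ := mul_right_eq hmul hsq hua hub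
  have hy := mul_right_eq_of_sq hmul hsq hua hub hup hpp
  have hmom := sq_mul_eq hsq huu hup huq hpp
  obtain ⟨r, hr⟩ := prime_dvd_setSum_pow_sub Nat.prime_three s
  obtain ⟨r', hr'⟩ := prime_dvd_setSum_pow_sub Nat.prime_three t
  obtain ⟨r5, hr5⟩ := prime_dvd_setSum_pow_sub Nat.prime_five t
  have pos_a : ∀ g, 0 ≤ a.coeff g := fun g => by
    rw [ha, coeff_setSum]; split_ifs <;> simp
  have pos_b : ∀ g, 0 ≤ b.coeff g := fun g => by
    rw [hb, coeff_setSum]; split_ifs <;> simp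
  have le_ab : ∀ g, (a + b).coeff g ≤ 2 := fun g => by
    rw [coeff_add, Finsupp.add_apply, ha, hb, coeff_setSum, coeff_setSum]; split_ifs <;> simp
  have pos_p : ∀ g, 0 ≤ p.coeff g := powHom_coeff_nonneg 2 fun g => add_nonneg (pos_a g) (pos_b g)
  have pos_q : ∀ g, 0 ≤ q.coeff g := powHom_coeff_nonneg 2 pos_p
  have inv_a : invHom a = a := invHom_setSum hs
  have inv_b : invHom b = b := invHom_setSum ht
  have inv_p : invHom p = p := by rw [hp, invHom_powHom, map_add, inv_a, inv_b]
  have sum_sq : ∑ g, ((p * a).coeff g ^ 2 + (p * b).coeff g ^ 2)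
      ≤ 8 * n ^ 2 + 8 * n - 2 + 2 * (2 * n + 1) + 2 * n * (2 * n - 2) := by
    rw [Finset.sum_add_distrib, sum_sq_coeff (by rw [map_mul, inv_p, inv_a]),
      sum_sq_coeff (by rw [map_mul, inv_p, inv_b]), ← Finsupp.add_apply, ← coeff_add]
    have e : p * a * (p * a) + p * b * (p * b)
        = ((8 * n ^ 2 + 8 * n - 2 : ℤ) : MonoidAlgebra ℤ H) * u
        + q * p - ((2 * n : ℤ) : MonoidAlgebra ℤ H) * q - ((2 * n - 2 : ℤ) : MonoidAlgebra ℤ H) * p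
        + ((2 * n * (2 * n - 2) : ℤ) : MonoidAlgebra ℤ H) * 1 := by
      push_cast
      linear_combination hmom
    rw [e]
    simp only [coeff_add, coeff_sub, Finsupp.add_apply, Finsupp.sub_apply, coeff_intCast_mul,
      hu, coeff_setSum, Finset.mem_univ, if_true, coeff_one_one]
    have h1 := coeff_powHom_one_le h2 pos_p le_ab
    rw [← hp, ← hq, map_add, augA, augB] at h1
    have h3 := mul_nonneg (show (0 : ℤ) ≤ 2 * n by positivity) (pos_q 1)
    have h4 := mul_nonneg (show (0 : ℤ) ≤ 2 * n - 2 by omega) (pos_p 1)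
    linarith
  have pointwise : ∀ g, 13 ≤ 3 * (q * b).coeff g + ((p * a).coeff g - 1) ^ 2
      + ((p * b).coeff g - 3) ^ 2 + 13 * (a.coeff g + b.coeff g + (powHom 3 a).coeff g
        + (powHom 3 b).coeff g + (powHom 5 b).coeff g) := fun g => by
    have hnn : 0 ≤ (p * a).coeff g ∧ 0 ≤ (p * b).coeff g ∧ 0 ≤ (q * b).coeff g :=
      ⟨coeff_mul_nonneg pos_p pos_a g, coeff_mul_nonneg pos_p pos_b g,
        coeff_mul_nonneg pos_q pos_b g⟩
    have e₀ : p * a = ((n - 1 : ℤ) : MonoidAlgebra ℤ H) * u + ((2 * n : ℤ) : MonoidAlgebra ℤ H) * a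
        + b - powHom 3 a - ((3 : ℤ) : MonoidAlgebra ℤ H) * r := by
      push_cast at hr ⊢
      linear_combination hx₀ - hr
    have e₁ : p * b = ((n + 2 : ℤ) : MonoidAlgebra ℤ H) * u + ((2 * n : ℤ) : MonoidAlgebra ℤ H) * b
        + a - powHom 3 b - ((3 : ℤ) : MonoidAlgebra ℤ H) * r' := by
      push_cast at hr' ⊢
      linear_combination hx₁ - hr'
    have e₂ : q * b = ((n ^ 3 + 4 * n ^ 2 + 9 * n + 5 : ℤ) : MonoidAlgebra ℤ H) * u
        + ((4 * n ^ 2 + 2 * n - 3 : ℤ) : MonoidAlgebra ℤ H) * b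
        + ((2 * n : ℤ) : MonoidAlgebra ℤ H) * a - ((4 * n : ℤ) : MonoidAlgebra ℤ H) * (p * b)
        - p * a - powHom 5 b - ((5 : ℤ) : MonoidAlgebra ℤ H) * r5 := by
      push_cast at hr5 ⊢
      linear_combination hy - hr5
    apply_fun (fun z => z.coeff g) at e₀ e₁ e₂
    simp only [coeff_add, coeff_sub, Finsupp.add_apply, Finsupp.sub_apply, coeff_intCast_mul,
      hu, coeff_setSum, Finset.mem_univ, if_true] at e₀ e₁ e₂
    have pa := pos_a g
    have pb := pos_b g
    have pa3 := powHom_coeff_nonneg 3 pos_a g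
    have pb3 := powHom_coeff_nonneg 3 pos_b g
    have pb5 := powHom_coeff_nonneg 5 pos_b g
    by_cases hz : a.coeff g + b.coeff g + (powHom 3 a).coeff g + (powHom 3 b).coeff g
        + (powHom 5 b).coeff g = 0
    · have za : a.coeff g = 0 := by linarith
      have zb : b.coeff g = 0 := by linarith
      have za3 : (powHom 3 a).coeff g = 0 := by linarith
      have zb3 : (powHom 3 b).coeff g = 0 := by linarith
      have zb5 : (powHom 5 b).coeff g = 0 := by linarith
      rw [za, zb, za3] at e₀
      rw [za, zb, zb3] at e₁
      rw [za, zb, zb5] at e₂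
      have hmod : (q * b).coeff g % 5
          = (2 + 2 * (p * b).coeff g - (p * a).coeff g) % 5 := by
        obtain ⟨k, hk⟩ : ∃ k : ℤ, (n : ℤ) = 5 * k + 2 := ⟨n / 5, by omega⟩
        rw [Int.emod_eq_emod_iff_emod_sub_eq_zero]
        refine Int.emod_eq_zero_of_dvd ⟨9 + 25 * k ^ 3 + 50 * k ^ 2 + 37 * k
          - 2 * (p * b).coeff g - 4 * k * (p * b).coeff g - r5.coeff g, ?_⟩
        rw [e₂, hk]
        ring
      rw [hz, mul_zero, add_zero]
      exact thirteen_le (by omega) (by omega) hnn.1 hnn.2.1 hnn.2.2 hmod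
    · have : 1 ≤ a.coeff g + b.coeff g + (powHom 3 a).coeff g + (powHom 3 b).coeff g
        + (powHom 5 b).coeff g := by omega
      nlinarith [sq_nonneg ((p * a).coeff g - 1), sq_nonneg ((p * b).coeff g - 3)]
  have hsum := Finset.sum_le_sum fun g (_ : g ∈ Finset.univ) => pointwise g
  have hx₀sum : ∑ g, (p * a).coeff g = (2 * n + 1) * n := by
    rw [← aug_apply, map_mul, augP, augA]
  have hx₁sum : ∑ g, (p * b).coeff g = (2 * n + 1) * (n + 1) := by
    rw [← aug_apply, map_mul, augP, augB]
  have hysum : ∑ g, (q * b).coeff g = (2 * n + 1) * (n + 1) := by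
    rw [← aug_apply, map_mul, augQ, augB]
  have expand : ∀ g, 3 * (q * b).coeff g + ((p * a).coeff g - 1) ^ 2
      + ((p * b).coeff g - 3) ^ 2 + 13 * (a.coeff g + b.coeff g + (powHom 3 a).coeff g
        + (powHom 3 b).coeff g + (powHom 5 b).coeff g)
      = 3 * (q * b).coeff g + ((p * a).coeff g ^ 2 + (p * b).coeff g ^ 2)
        - 2 * (p * a).coeff g - 6 * (p * b).coeff g + 10 + 13 * (a.coeff g + b.coeff g
        + (powHom 3 a).coeff g + (powHom 3 b).coeff g + (powHom 5 b).coeff g) := fun g => by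
    ring
  simp only [expand] at hsum
  simp only [Finset.sum_add_distrib, Finset.sum_sub_distrib, ← Finset.mul_sum, hx₀sum, hx₁sum,
    hysum, ← aug_apply, aug_powHom, augA, augB, Finset.sum_const, Finset.card_univ, hcard,
    nsmul_eq_mul] at hsum sum_sq
  push_cast at hsum
  have : (114 : ℤ) ≤ n := by exact_mod_cast hge
  nlinarith

end APLL

/-- Nonexistence of inverse-closed subsets `T₀, T₁` with `e ∈ T₀` satisfying the
APLL group-ring equations, in any finite abelian group of order `n²+n+1`. -/
theorem no_APLL_subsets_odd_ge114_2mod5_2mod3 (n : ℕ) (hn : 0 < n)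
    (hodd : Odd n) (hge : 114 ≤ n) (h5 : n % 5 = 2) (h3 : n % 3 = 2)
    (H : Type*) [CommGroup H] [Fintype H]
    (hcard : Fintype.card H = n ^ 2 + n + 1) :
    ¬ ∃ T₀ T₁ : Set H,
        T₀⁻¹ = T₀ ∧ T₁⁻¹ = T₁ ∧ (1 : H) ∈ T₀ ∧ APLLEqs n T₀ T₁ := by
  rintro ⟨T₀, T₁, hinv₀, hinv₁, hone, hmul, hsq⟩
  have hH : Odd (Fintype.card H) := hcard ▸ APLL.odd_sq_add_add_one n
  set s := T₀.toFinset with hs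
  set t := T₁.toFinset with ht
  have mem_s : ∀ g, g ∈ s ↔ g ∈ T₀ := fun g => by simp [hs]
  have mem_t : ∀ g, g ∈ t ↔ g ∈ T₁ := fun g => by simp [ht]
  have inv_s : ∀ g, g⁻¹ ∈ s ↔ g ∈ s := fun g => by
    rw [mem_s, mem_s, ← Set.mem_inv, hinv₀]
  have inv_t : ∀ g, g⁻¹ ∈ t ↔ g ∈ t := fun g => by
    rw [mem_t, mem_t, ← Set.mem_inv, hinv₁]
  have hst : APLL.setSum s * APLL.setSum t = APLL.setSum Finset.univ - 1 := by
    ext h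
    rw [APLL.coeff_setSum_mul, MonoidAlgebra.coeff_sub, Finsupp.sub_apply, APLL.coeff_setSum]
    simp only [mem_s, mem_t, hmul, MonoidAlgebra.one_def, MonoidAlgebra.coeff_single,
      Finsupp.single_apply, Finset.mem_univ, if_true, eq_comm (a := (1 : H))]
    split_ifs <;> simp
  have hss : APLL.setSum s ^ 2 + APLL.setSum t ^ 2 = 2 * APLL.setSum Finset.univ
      - APLL.powHom 2 (APLL.setSum s + APLL.setSum t) + 2 * (n : MonoidAlgebra ℤ H) := by
    suffices APLL.setSum s * APLL.setSum s + APLL.setSum t * APLL.setSum t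
        + APLL.powHom 2 (APLL.setSum s) + APLL.powHom 2 (APLL.setSum t)
        = ((2 : ℤ) : MonoidAlgebra ℤ H) * APLL.setSum Finset.univ
          + ((2 * n : ℤ) : MonoidAlgebra ℤ H) * 1 by
      push_cast at this
      rw [map_add]
      linear_combination this
    ext h
    simp only [MonoidAlgebra.coeff_add, Finsupp.add_apply, APLL.coeff_setSum_mul,
      APLL.coeff_powHom_setSum, APLL.coeff_intCast_mul, APLL.coeff_setSum, mem_s, mem_t,
      MonoidAlgebra.one_def, MonoidAlgebra.coeff_single, Finsupp.single_apply, Finset.mem_univ,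
      if_true, eq_comm (a := (1 : H))]
    have := hsq h
    zify at this
    rw [this]
    split_ifs <;> simp
  have cmul := congrArg APLL.aug hst
  have csq := congrArg APLL.aug hss
  simp only [map_mul, map_add, map_sub, map_pow, map_one, map_ofNat, map_natCast,
    APLL.aug_powHom, APLL.aug_setSum, Finset.card_univ, hcard] at cmul csq
  push_cast at cmul csq
  have hsc : s.card = n ∧ t.card = n + 1 := by
    have h := APLL.eq_or_eq_of_mul_of_sq (n := n) (s := s.card) (t := t.card) (by positivity)
      (by positivity) (by positivity) (by linarith) (by linarith)
    have hs_odd := APLL.odd_card_of_inv_mem hH inv_s ((mem_s 1).mpr hone)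
    rw [Nat.odd_iff] at hs_odd hodd
    omega
  exact APLL.false_of_groupRing_eqs hge h5 h3 hcard inv_s inv_t hsc.1 hsc.2 hst hss
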